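/- Let (x_n)_{n ≥ 1} be any sequence of points in ℝ with |x_n| = n + 1 for all n, let η : ℝ → (0,1] be defined by η(x) = min{1, 1/(|x| log|x|)} for |x| > 1 (and η(x) = 1 for |x| ≤ 1), and set E = ⋃_{n ≥ 1} B(x_n, η(x_n)). Then E has infinite Lebesgue measure, and E is very thin at infinity. -/

import Mathlib

open MeasureTheory Filter Metric

noncomputable section

/-- The radial function `ρ(x) = min {1, 1/|x|}` on `ℝ`. -/
def rhoR (x : ℝ) : ℝ := if |x| ≤ 1 then 1 else |x|⁻¹

/-- A set `E ⊆ ℝ` is very thin at infinity if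
`|E ∩ B(x, ρ(x))| / |B(x, ρ(x))| → 0` as `|x| → ∞`. -/
def VeryThinAtInfinityR (E : Set ℝ) : Prop :=
  Tendsto (fun x : ℝ =>
      volume (E ∩ ball x (rhoR x)) / volume (ball x (rhoR x)))
    (comap (fun x : ℝ => |x|) atTop) (nhds 0)

/-- The function `η(x) = min {1, 1/(|x| log |x|)}` for `|x| > 1` and `η(x) = 1` for `|x| ≤ 1`. -/
noncomputable def eta (x : ℝ) : ℝ := if |x| ≤ 1 then 1 else min 1 (|x| * Real.log |x|)⁻¹

/-- The series `∑ 1 / (n log n)` diverges. -/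
theorem not_summable_inv_natCast_mul_log :
    ¬ Summable fun n : ℕ => ((n : ℝ) * Real.log n)⁻¹ := by
  have h_nonneg : ∀ n : ℕ, 0 ≤ ((n : ℝ) * Real.log n)⁻¹ := fun n => by
    have := Real.log_natCast_nonneg n
    positivity
  have h_mono : ∀ᶠ n : ℕ in atTop,
      (((n + 1 : ℕ) : ℝ) * Real.log (n + 1 : ℕ))⁻¹ ≤ ((n : ℝ) * Real.log n)⁻¹ := by
    filter_upwards [eventually_ge_atTop 2] with n hn
    have hn' : (1 : ℝ) < n := by exact_mod_cast hn
    have hlog : 0 < Real.log n := Real.log_pos hn'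
    have hle : (n : ℝ) ≤ (n + 1 : ℕ) := by simp
    gcongr
  rw [← summable_condensed_iff_of_eventually_nonneg (Eventually.of_forall h_nonneg) h_mono]
  intro h
  have h' := h.mul_right (Real.log 2)
  refine Real.not_summable_one_div_natCast (h'.congr fun k => ?_)
  have hlog : Real.log 2 ≠ 0 := (Real.log_pos one_lt_two).ne'
  push_cast
  rw [Real.log_pow]
  rcases eq_or_ne k 0 with rfl | hk
  · simp
  · field_simp

theorem one_lt_log_of_three_le {t : ℝ} (ht : 3 ≤ t) : 1 < Real.log t := by
  rw [Real.lt_log_iff_exp_lt (by linarith)]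
  exact Real.exp_one_lt_three.trans_le ht

theorem eta_of_three_le {y : ℝ} (hy : 3 ≤ |y|) : eta y = (|y| * Real.log |y|)⁻¹ := by
  have hlog := one_lt_log_of_three_le hy
  rw [eta, if_neg (by linarith), min_eq_right]
  exact inv_le_one_of_one_le₀ (by nlinarith)

theorem eta_le_inv_of_le {y s : ℝ} (hs : 3 ≤ s) (hy : s ≤ |y|) :
    eta y ≤ (s * Real.log s)⁻¹ := by
  rw [eta_of_three_le (hs.trans hy)]
  have hlog := one_lt_log_of_three_le hs
  gcongr

theorem eta_le_third {y : ℝ} (hy : 3 ≤ |y|) : eta y ≤ 1 / 3 := by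
  refine (eta_le_inv_of_le le_rfl hy).trans ?_
  have hlog := one_lt_log_of_three_le (le_refl 3)
  rw [one_div]
  gcongr
  linarith

theorem eta_le_one (y : ℝ) : eta y ≤ 1 := by
  unfold eta
  split_ifs <;> simp

theorem one_le_abs_sub_of_ne {x : ℕ → ℝ} (hx : ∀ n : ℕ, 1 ≤ n → |x n| = (n : ℝ) + 1)
    {m n : ℕ} (hm : 1 ≤ m) (hn : 1 ≤ n) (hmn : m ≠ n) : 1 ≤ |x m - x n| := by
  refine le_trans ?_ (abs_abs_sub_abs_le_abs_sub (x m) (x n))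
  rw [hx m hm, hx n hn, add_sub_add_right_eq_sub]
  have : (1 : ℤ) ≤ |(m : ℤ) - n| := Int.one_le_abs (sub_ne_zero.mpr (by exact_mod_cast hmn))
  exact_mod_cast this

theorem volume_iUnion_ball_eta_eq_top {x : ℕ → ℝ}
    (hx : ∀ n : ℕ, 1 ≤ n → |x n| = (n : ℝ) + 1) :
    volume (⋃ n ≥ 1, ball (x n) (eta (x n))) = ⊤ := by
  have hx' : ∀ n : ℕ, |x (n + 2)| = ((n + 3 : ℕ) : ℝ) := fun n => by
    rw [hx _ (by omega)]
    push_cast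
    ring
  have h3 : ∀ n : ℕ, 3 ≤ |x (n + 2)| := fun n => by
    rw [hx']
    exact_mod_cast Nat.le_add_left 3 n
  have hsub : (⋃ n : ℕ, ball (x (n + 2)) (eta (x (n + 2)))) ⊆
      ⋃ n ≥ 1, ball (x n) (eta (x n)) :=
    Set.iUnion_subset fun n =>
      Set.subset_biUnion_of_mem (u := fun n => ball (x n) (eta (x n)))
        (show n + 2 ∈ {n | n ≥ 1} by simp)
  have hdisj : Pairwise (Function.onFun Disjoint
      fun n : ℕ => ball (x (n + 2)) (eta (x (n + 2)))) := fun m n hmn => by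
    refine ball_disjoint_ball ?_
    have h1 := one_le_abs_sub_of_ne hx (m := m + 2) (n := n + 2) (by omega) (by omega) (by omega)
    rw [Real.dist_eq]
    linarith [eta_le_third (h3 m), eta_le_third (h3 n)]
  refine measure_mono_top hsub ?_
  rw [measure_iUnion hdisj fun _ => measurableSet_ball]
  by_contra hfin
  refine not_summable_inv_natCast_mul_log ((summable_nat_add_iff 3).mp ?_)
  refine ((ENNReal.summable_toReal hfin).mul_right (1 / 2)).congr fun n => ?_
  have hlog := one_lt_log_of_three_le (h3 n)
  have hpos : 0 ≤ eta (x (n + 2)) := by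
    rw [eta_of_three_le (h3 n)]
    positivity
  rw [Real.volume_ball, ENNReal.toReal_ofReal (by positivity), eta_of_three_le (h3 n), hx']
  ring

/-- Far from the origin, a ball of radius `ρ` meets at most one of the balls `B(x_n, η(x_n))`. -/
theorem volume_iUnion_ball_eta_inter_ball_le {x : ℕ → ℝ}
    (hx : ∀ n : ℕ, 1 ≤ n → |x n| = (n : ℝ) + 1) {y : ℝ} (hy : 8 ≤ |y|) :
    volume ((⋃ n ≥ 1, ball (x n) (eta (x n))) ∩ ball y |y|⁻¹) ≤
      ENNReal.ofReal (2 * (|y| / 2 * Real.log (|y| / 2))⁻¹) := by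
  have hinv : |y|⁻¹ ≤ 1 / 8 := by
    rw [one_div]
    gcongr
  have hfar : ∀ n z, z ∈ ball (x n) (eta (x n)) → z ∈ ball y |y|⁻¹ → |y| / 2 ≤ |x n| := by
    intro n z hz hzy
    rw [mem_ball, Real.dist_eq] at hz hzy
    have h1 := eta_le_one (x n)
    have h2 := abs_sub_abs_le_abs_sub y (x n)
    have h3 := abs_sub_le y z (x n)
    rw [abs_sub_comm y z] at h3
    linarith
  rcases ((⋃ n ≥ 1, ball (x n) (eta (x n))) ∩ ball y |y|⁻¹).eq_empty_or_nonempty with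
    hE | ⟨z, hz, hzy⟩
  · simp [hE]
  · simp only [Set.mem_iUnion] at hz
    obtain ⟨n, hn, hzn⟩ := hz
    have hyn := hfar n z hzn hzy
    have hsub : (⋃ n ≥ 1, ball (x n) (eta (x n))) ∩ ball y |y|⁻¹ ⊆ ball (x n) (eta (x n)) := by
      rintro w ⟨hw, hwy⟩
      simp only [Set.mem_iUnion] at hw
      obtain ⟨m, hm, hwm⟩ := hw
      have hym := hfar m w hwm hwy
      rcases eq_or_ne m n with rfl | hmn
      · exact hwm
      · have hsep := one_le_abs_sub_of_ne hx hm hn hmn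
        have hm3 := eta_le_third (show 3 ≤ |x m| by linarith)
        have hn3 := eta_le_third (show 3 ≤ |x n| by linarith)
        rw [mem_ball, Real.dist_eq] at hzn hzy hwm hwy
        rw [abs_sub_comm] at hwm hzy
        have h1 := abs_sub_le (x m) w (x n)
        have h2 := abs_sub_le w y (x n)
        have h3 := abs_sub_le y z (x n)
        linarith
    refine (measure_mono hsub).trans ?_
    rw [Real.volume_ball]
    gcongr
    exact eta_le_inv_of_le (by linarith) hyn

theorem veryThinAtInfinityR_iUnion_ball_eta {x : ℕ → ℝ}
    (hx : ∀ n : ℕ, 1 ≤ n → |x n| = (n : ℝ) + 1) :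
    VeryThinAtInfinityR (⋃ n ≥ 1, ball (x n) (eta (x n))) := by
  have hlim : Tendsto (fun y : ℝ => ENNReal.ofReal (2 / Real.log (|y| / 2)))
      (comap (fun y : ℝ => |y|) atTop) (nhds 0) := by
    rw [← ENNReal.ofReal_zero]
    refine ENNReal.tendsto_ofReal ?_
    exact (Real.tendsto_log_atTop.comp
      (tendsto_comap.atTop_div_const two_pos)).const_div_atTop 2
  refine tendsto_of_tendsto_of_tendsto_of_le_of_le' tendsto_const_nhds hlim
    (Eventually.of_forall fun _ => zero_le) ?_
  filter_upwards [tendsto_comap.eventually (eventually_ge_atTop (8 : ℝ))] with y hy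
  have hlog := one_lt_log_of_three_le (show 3 ≤ |y| / 2 by linarith)
  have hypos : 0 < |y| := by linarith
  have hrho : rhoR y = |y|⁻¹ := if_neg (by linarith)
  rw [hrho]
  refine (ENNReal.div_le_div_right (volume_iUnion_ball_eta_inter_ball_le hx hy) _).trans ?_
  rw [Real.volume_ball, ← ENNReal.ofReal_div_of_pos (by positivity)]
  refine ENNReal.ofReal_le_ofReal (le_of_eq ?_)
  field_simp

/-- If `|x_n| = n + 1` and `E = ⋃_{n ≥ 1} B(x_n, η(x_n))`, then `E` has infinite Lebesgue
measure and `E` is very thin at infinity. -/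
theorem infinite_measure_veryThinAtInfinity (x : ℕ → ℝ)
    (hx : ∀ n : ℕ, 1 ≤ n → |x n| = (n : ℝ) + 1) :
    volume (⋃ n ≥ 1, ball (x n) (eta (x n))) = ⊤ ∧
      VeryThinAtInfinityR (⋃ n ≥ 1, ball (x n) (eta (x n))) :=
  ⟨volume_iUnion_ball_eta_eq_top hx, veryThinAtInfinityR_iUnion_ball_eta hx⟩
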